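/- Existence of an optimal policy for the smoothed inventory-storage problem: for every initial condition (x₀, y₀) ∈ ℝ² with x₀ ≤ y₀, there exists u* ∈ S_u such that Ĵ_σ(u*) ≥ Ĵ_σ(u) for every u ∈ S_u; i.e. the supremum of Ĵ_σ over S_u is attained. -/

import Mathlib

open MeasureTheory Set
open scoped NNReal

noncomputable section

/-- Combined holding/shortage cost with holding factor `Ch` and shortage factor `Cs`. -/
def holding (Ch Cs x : ℝ) : ℝ := if x < 0 then Cs * x ^ 2 else Ch * x ^ 2

/-- The piecewise-linear smoothing function ψ_δ. -/
def psiδ (δ d : ℝ) : ℝ := if d < -δ then 0 else if d ≤ 0 then 1 + d / δ else 1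

/-- Membership in the reduced policy space `S_u`. -/
def memSu (T a : ℝ) (α β : ℝ → ℝ) (u : ℝ → ℝ) : Prop :=
  Measurable u ∧ ∀ t ∈ Icc (0 : ℝ) T, 0 ≤ u t ∧ u t ≤ α t / (2 * a * β t)

/-- The state `(x, y)` of the smoothed inventory-storage system under control `u`,
with initial condition `(x₀, y₀)`. -/
def IsStateInv (T a δ : ℝ) (α β : ℝ → ℝ) (u : ℝ → ℝ) (x₀ y₀ : ℝ)
    (x y : ℝ → ℝ) : Prop :=
  ContinuousOn x (Icc 0 T) ∧ ContinuousOn y (Icc 0 T) ∧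
  ∀ t ∈ Icc (0 : ℝ) T,
    x t = x₀ + (∫ s in (0 : ℝ)..t, (u s * (1 + a * β s) - α s / 2)) ∧
    y t = y₀ + (∫ s in (0 : ℝ)..t,
      max (u s * (1 + a * β s) - α s / 2) 0 * psiδ δ (x s - y s))

/-- The smoothed objective `Ĵ_σ(u)` evaluated along the state `(x, y)`. -/
def JhatInv (T a σ Ch Cs ChT CsT : ℝ) (α β : ℝ → ℝ) (u x y : ℝ → ℝ) : ℝ :=
  (∫ s in (0 : ℝ)..T,
    (-(a * u s ^ 2 * (1 + a * β s)) + α s ^ 2 / (4 * β s) - holding Ch Cs (x s)))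
  - holding ChT CsT (x T) - σ * y T

/-- Weak convergence of a sequence of functions, tested against essentially bounded functions. -/
def WeakTendsto {X : Type*} [MeasurableSpace X] (μ : Measure X) (f : ℕ → X → ℝ) (g : X → ℝ) :
    Prop :=
  ∀ h : X → ℝ, MemLp h ⊤ μ →
    Filter.Tendsto (fun n => ∫ s, h s * f n s ∂μ) Filter.atTop (nhds (∫ s, h s * g s ∂μ))

section Weak

variable {X : Type*} [MeasurableSpace X] {μ : Measure X}

lemma WeakTendsto.const (g : X → ℝ) : WeakTendsto μ (fun _ => g) g :=
  fun _ _ => tendsto_const_nhds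

lemma WeakTendsto.comp_strictMono {f : ℕ → X → ℝ} {g : X → ℝ} (h : WeakTendsto μ f g)
    {φ : ℕ → ℕ} (hφ : StrictMono φ) : WeakTendsto μ (fun n => f (φ n)) g :=
  fun k hk => (h k hk).comp hφ.tendsto_atTop

lemma WeakTendsto.ae_le {f k : ℕ → X → ℝ} {g l : X → ℝ} (hf : WeakTendsto μ f g)
    (hk : WeakTendsto μ k l) (hfi : ∀ n, Integrable (f n) μ) (hki : ∀ n, Integrable (k n) μ)
    (hgi : Integrable g μ) (hli : Integrable l μ) (hle : ∀ n, f n ≤ᵐ[μ] k n) :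
    g ≤ᵐ[μ] l := by
  refine ae_le_of_forall_setIntegral_le hgi hli fun s hs _ => ?_
  have hmem : MemLp (s.indicator fun _ => (1 : ℝ)) ⊤ μ :=
    memLp_top_of_bound (aestronglyMeasurable_const.indicator hs) 1
      (.of_forall fun x => by by_cases hx : x ∈ s <;> simp [hx])
  have key : ∀ F : X → ℝ, ∫ x, s.indicator (fun _ => (1 : ℝ)) x * F x ∂μ = ∫ x in s, F x ∂μ := by
    intro F
    rw [← integral_indicator hs]
    congr 1 with x
    by_cases hx : x ∈ s <;> simp [hx]
  have h1 := hf _ hmem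
  have h2 := hk _ hmem
  simp only [key] at h1 h2
  exact le_of_tendsto_of_tendsto' h1 h2 fun n =>
    setIntegral_mono_ae (hfi n).integrableOn (hki n).integrableOn (hle n)

lemma integrable_of_memLp_top [IsFiniteMeasure μ] {f : X → ℝ} (hf : MemLp f ⊤ μ) :
    Integrable f μ := hf.integrable le_top

lemma memLp_top_mul {f g : X → ℝ} (hf : MemLp f ⊤ μ) (hg : MemLp g ⊤ μ) :
    MemLp (fun x => f x * g x) ⊤ μ := MemLp.mul' hg hf

/-- Essentially bounded sequences are weakly sequentially compact. -/
lemma exists_weakTendsto_of_bound [MeasurableSpace.CountablyGenerated X] [IsFiniteMeasure μ]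
    {f : ℕ → X → ℝ} {C : ℝ} (hf : ∀ n, AEStronglyMeasurable (f n) μ)
    (hC : ∀ n, ∀ᵐ x ∂μ, ‖f n x‖ ≤ C) :
    ∃ φ : ℕ → ℕ, StrictMono φ ∧ ∃ g : X → ℝ, Measurable g ∧ (∀ᵐ x ∂μ, ‖g x‖ ≤ C) ∧
      WeakTendsto μ (fun n => f (φ n)) g := by
  have : Fact ((2 : ENNReal) ≠ ⊤) := ⟨by simp⟩
  have hC' : ∀ n, ∀ᵐ x ∂μ, ‖f n x‖ ≤ |C| := fun n =>
    (hC n).mono fun x hx => hx.trans (le_abs_self C)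
  have h2 : ∀ {h : X → ℝ}, MemLp h ⊤ μ → MemLp h 2 μ := fun h => h.mono_exponent le_top
  have htop : ∀ n, MemLp (f n) ⊤ μ := fun n => memLp_top_of_bound (hf n) C (hC n)
  let F : ℕ → Lp ℝ 2 μ := fun n => (h2 (htop n)).toLp (f n)
  have hF : ∀ n, F n =ᵐ[μ] f n := fun n => MemLp.coeFn_toLp _
  let R : ℝ := ↑(measureUnivNNReal μ) ^ (2 : ENNReal).toReal⁻¹ * |C|
  have hR : ∀ n, ‖F n‖ ≤ R := fun n => Lp.norm_le_of_ae_bound (abs_nonneg C) (by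
    filter_upwards [hF n, hC' n] with x h1 h2
    rwa [h1])
  let D : ℕ → WeakDual ℝ (Lp ℝ 2 μ) := fun n =>
    StrongDual.toWeakDual (InnerProductSpace.toDual ℝ (Lp ℝ 2 μ) (F n))
  have hD : ∀ n, D n ∈ WeakDual.toStrongDual ⁻¹' Metric.closedBall
      (0 : StrongDual ℝ (Lp ℝ 2 μ)) R := by
    intro n
    simp only [mem_preimage, mem_closedBall_zero_iff]
    change ‖InnerProductSpace.toDual ℝ (Lp ℝ 2 μ) (F n)‖ ≤ R
    rw [LinearIsometryEquiv.norm_map]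
    exact hR n
  obtain ⟨L, -, φ, hφ, hL⟩ := WeakDual.isSeqCompact_closedBall ℝ (Lp ℝ 2 μ) 0 R hD
  let G : Lp ℝ 2 μ := (InnerProductSpace.toDual ℝ (Lp ℝ 2 μ)).symm (WeakDual.toStrongDual L)
  have hweak : WeakTendsto μ (fun n => f (φ n)) G := by
    intro h hh
    let H : Lp ℝ 2 μ := (h2 hh).toLp h
    have hH : H =ᵐ[μ] h := MemLp.coeFn_toLp _
    have h1 := ((WeakDual.eval_continuous H).tendsto L).comp hL
    have e1 : ∀ n, (D n) H = ∫ s, h s * f n s ∂μ := by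
      intro n
      change InnerProductSpace.toDual ℝ (Lp ℝ 2 μ) (F n) H = _
      rw [InnerProductSpace.toDual_apply_apply, L2.inner_def]
      refine integral_congr_ae ?_
      filter_upwards [hH, hF n] with x ha hb
      simp [ha, hb]
    have e2 : L H = ∫ s, h s * G s ∂μ := by
      have : L H = InnerProductSpace.toDual ℝ (Lp ℝ 2 μ) G H := by
        simp [G]
      rw [this, InnerProductSpace.toDual_apply_apply, L2.inner_def]
      refine integral_congr_ae ?_
      filter_upwards [hH] with x ha
      simp [ha]
    rw [← e2]
    refine h1.congr fun n => ?_
    exact e1 (φ n)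
  refine ⟨φ, hφ, G, (Lp.stronglyMeasurable G).measurable, ?_, hweak⟩
  have hGi : Integrable G μ := (Lp.memLp G).integrable (by norm_num)
  have hfi : ∀ n, Integrable (f (φ n)) μ := fun n => integrable_of_memLp_top (htop _)
  have hup := hweak.ae_le (WeakTendsto.const fun _ => C) hfi (fun _ => integrable_const C) hGi
    (integrable_const C) fun n => (hC (φ n)).mono fun x hx => (abs_le.1 hx).2
  have hlo := (WeakTendsto.const fun _ => -C).ae_le hweak (fun _ => integrable_const (-C)) hfi
    (integrable_const (-C)) hGi fun n => (hC (φ n)).mono fun x hx => (abs_le.1 hx).1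
  filter_upwards [hup, hlo] with x h1 h2
  exact abs_le.2 ⟨h2, h1⟩

/-- The product of a weakly convergent sequence with a boundedly a.e. convergent one converges
weakly to the product of the limits. -/
lemma WeakTendsto.mul [IsFiniteMeasure μ] {f q : ℕ → X → ℝ} {g p : X → ℝ} {C D : ℝ}
    (hf : WeakTendsto μ f g) (hfm : ∀ n, AEStronglyMeasurable (f n) μ)
    (hfC : ∀ n, ∀ᵐ x ∂μ, ‖f n x‖ ≤ C) (hqm : ∀ n, AEStronglyMeasurable (q n) μ)
    (hpm : AEStronglyMeasurable p μ) (hqD : ∀ n, ∀ᵐ x ∂μ, ‖q n x‖ ≤ D)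
    (hpD : ∀ᵐ x ∂μ, ‖p x‖ ≤ D)
    (hqp : ∀ᵐ x ∂μ, Filter.Tendsto (fun n => q n x) Filter.atTop (nhds (p x))) :
    WeakTendsto μ (fun n x => q n x * f n x) (fun x => p x * g x) := by
  intro h hh
  have hft : ∀ n, MemLp (f n) ⊤ μ := fun n => memLp_top_of_bound (hfm n) C (hfC n)
  have hqt : ∀ n, MemLp (q n) ⊤ μ := fun n => memLp_top_of_bound (hqm n) D (hqD n)
  have hpt : MemLp p ⊤ μ := memLp_top_of_bound hpm D hpD
  have h1 := hf _ (memLp_top_mul hh hpt)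
  have h2 : Filter.Tendsto (fun n => ∫ x, h x * (q n x - p x) * f n x ∂μ) Filter.atTop
      (nhds (∫ _, 0 ∂μ)) := by
    refine tendsto_integral_of_dominated_convergence (fun x => ‖h x‖ * (D + D) * C)
      (fun n => (hh.1.mul ((hqm n).sub hpm)).mul (hfm n)) ?_ ?_ ?_
    · exact ((integrable_of_memLp_top hh).norm.mul_const _).mul_const _
    · intro n
      filter_upwards [hfC n, hqD n, hpD] with x h1 h2 h3
      rw [norm_mul, norm_mul]
      have : ‖q n x - p x‖ ≤ D + D := (norm_sub_le _ _).trans (add_le_add h2 h3)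
      have : 0 ≤ D := (norm_nonneg _).trans h2
      gcongr
    · filter_upwards [ae_all_iff.2 hfC, hqp] with x h1 h2
      refine squeeze_zero_norm (a := fun n => ‖h x‖ * ‖q n x - p x‖ * C) (fun n => ?_) ?_
      · rw [norm_mul, norm_mul]
        gcongr
        exact h1 n
      · have : Filter.Tendsto (fun n => ‖q n x - p x‖) Filter.atTop (nhds 0) := by
          simpa using (h2.sub_const (p x)).norm
        simpa using (this.const_mul ‖h x‖).mul_const C
  have h3 := h1.add h2
  simp only [integral_zero, add_zero] at h3
  have e : ∫ x, h x * p x * g x ∂μ = ∫ x, h x * (p x * g x) ∂μ := by simp only [mul_assoc]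
  rw [e] at h3
  refine h3.congr fun n => ?_
  rw [← integral_add]
  · congr 1 with x
    ring
  · exact integrable_of_memLp_top (memLp_top_mul (memLp_top_mul hh hpt) (hft n))
  · exact integrable_of_memLp_top
      (memLp_top_mul (memLp_top_mul hh ((hqt n).sub hpt)) (hft n))

end Weak

lemma intervalIntegral_eq_integral_indicator_mul {T t : ℝ} (ht : t ∈ Icc 0 T) (f : ℝ → ℝ) :
    ∫ s in (0 : ℝ)..t, f s =
      ∫ s, (Ioc 0 t).indicator (fun _ => (1 : ℝ)) s * f s ∂volume.restrict (Ioc 0 T) := by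
  rw [intervalIntegral.integral_of_le ht.1]
  have : ∀ s, (Ioc 0 t).indicator (fun _ => (1 : ℝ)) s * f s = (Ioc 0 t).indicator f s := by
    intro s
    by_cases hs : s ∈ Ioc 0 t <;> simp [hs]
  simp only [this]
  rw [integral_indicator measurableSet_Ioc, Measure.restrict_restrict measurableSet_Ioc,
    inter_eq_left.2 (Ioc_subset_Ioc_right ht.2)]

lemma WeakTendsto.tendsto_primitive {T t : ℝ} {f : ℕ → ℝ → ℝ} {g : ℝ → ℝ}
    (h : WeakTendsto (volume.restrict (Ioc 0 T)) f g) (ht : t ∈ Icc 0 T) :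
    Filter.Tendsto (fun n => ∫ s in (0 : ℝ)..t, f n s) Filter.atTop
      (nhds (∫ s in (0 : ℝ)..t, g s)) := by
  simp only [intervalIntegral_eq_integral_indicator_mul ht]
  exact h _ (memLp_top_of_bound (aestronglyMeasurable_const.indicator measurableSet_Ioc) 1
    (.of_forall fun x => by by_cases hx : x ∈ Ioc 0 t <;> simp [hx]))

/-- A Carathéodory differential equation whose right-hand side is Lipschitz in the state has a
solution for every initial value. -/
lemma exists_caratheodory_solution {T K : ℝ} (hT : 0 ≤ T) (hK : 0 < K) {G : ℝ → ℝ → ℝ}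
    (hint : ∀ z : ℝ → ℝ, Continuous z → IntegrableOn (fun s => G s (z s)) (Icc 0 T))
    (hLip : ∀ s ∈ Icc 0 T, ∀ a b, |G s a - G s b| ≤ K * |a - b|) (y₀ : ℝ) :
    ∃ y : ℝ → ℝ, Continuous y ∧ ∀ t ∈ Icc 0 T, y t = y₀ + ∫ s in (0 : ℝ)..t, G s (y s) := by
  let L : ℝ := 2 * K
  let E : C(Icc 0 T, ℝ) → ℝ → ℝ := fun z s => Real.exp (L * s) * IccExtend hT z s
  have hE : ∀ z, Continuous (E z) := fun z =>
    (Real.continuous_exp.comp (continuous_const.mul continuous_id)).mul z.continuous.Icc_extend'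
  have hprim : ∀ z, ContinuousOn (fun t => ∫ s in (0 : ℝ)..t, G s (E z s)) (Icc 0 T) := by
    intro z
    have := intervalIntegral.continuousOn_primitive_interval (μ := volume) (a := 0) (b := T)
      (f := fun s => G s (E z s)) (by rw [uIcc_of_le hT]; exact hint _ (hE z))
    rwa [uIcc_of_le hT] at this
  let Φ : C(Icc 0 T, ℝ) → C(Icc 0 T, ℝ) := fun z =>
    ⟨fun t => Real.exp (-(L * t)) * (y₀ + ∫ s in (0 : ℝ)..t, G s (E z s)),
      (Real.continuous_exp.comp (by fun_prop)).mul
        (continuous_const.add (continuousOn_iff_continuous_domRestrict.1 (hprim z)))⟩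
  have hii : ∀ z (t : Icc 0 T), IntervalIntegrable (fun s => G s (E z s)) volume 0 t := by
    intro z t
    rw [intervalIntegrable_iff_integrableOn_Ioc_of_le t.2.1]
    exact (hint _ (hE z)).mono_set
      (Ioc_subset_Icc_self.trans (Icc_subset_Icc_right t.2.2))
  have hcontr : ContractingWith (1 / 2) Φ := by
    refine ⟨by norm_num, LipschitzWith.of_dist_le_mul fun z w => ?_⟩
    rw [ContinuousMap.dist_le (by positivity)]
    intro t
    have hb : ‖∫ s in (0 : ℝ)..t, (G s (E z s) - G s (E w s))‖
        ≤ ∫ s in (0 : ℝ)..t, K * dist z w * Real.exp (L * s) := by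
      refine intervalIntegral.norm_integral_le_of_norm_le t.2.1 (.of_forall fun s hs => ?_)
        (Continuous.intervalIntegrable (by fun_prop) _ _)
      have hs' : s ∈ Icc 0 T := ⟨hs.1.le, hs.2.trans t.2.2⟩
      refine (hLip s hs' _ _).trans ?_
      have h1 : E z s - E w s = Real.exp (L * s) * (z ⟨s, hs'⟩ - w ⟨s, hs'⟩) := by
        simp only [E, IccExtend_of_mem hT _ hs']
        ring
      have h2 : |z ⟨s, hs'⟩ - w ⟨s, hs'⟩| ≤ dist z w := by
        rw [← Real.dist_eq]
        exact ContinuousMap.dist_apply_le_dist _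
      rw [h1, abs_mul, abs_of_pos (Real.exp_pos _)]
      calc K * (Real.exp (L * s) * |z ⟨s, hs'⟩ - w ⟨s, hs'⟩|)
          ≤ K * (Real.exp (L * s) * dist z w) := by gcongr
        _ = K * dist z w * Real.exp (L * s) := by ring
    have hI : ∫ s in (0 : ℝ)..t, K * dist z w * Real.exp (L * s)
        = dist z w / 2 * (Real.exp (L * t) - 1) := by
      rw [intervalIntegral.integral_const_mul, intervalIntegral.integral_comp_mul_left
        (fun s => Real.exp s) (by positivity : L ≠ 0)]
      simp only [integral_exp, mul_zero, Real.exp_zero, smul_eq_mul, L]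
      field_simp
    have he : Φ z t - Φ w t = Real.exp (-(L * t)) *
        ∫ s in (0 : ℝ)..t, (G s (E z s) - G s (E w s)) := by
      rw [intervalIntegral.integral_sub (hii z t) (hii w t)]
      simp only [Φ, ContinuousMap.coe_mk]
      ring
    rw [Real.dist_eq, he, abs_mul, abs_of_pos (Real.exp_pos _)]
    rw [hI, Real.norm_eq_abs] at hb
    have hee : Real.exp (-(L * t)) * Real.exp (L * t) = 1 := by
      rw [← Real.exp_add]; simp
    calc _ ≤ Real.exp (-(L * t)) * (dist z w / 2 * (Real.exp (L * t) - 1)) := by gcongr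
      _ = dist z w / 2 * (1 - Real.exp (-(L * t))) := by linear_combination dist z w / 2 * hee
      _ ≤ dist z w / 2 * 1 := by
        gcongr
        linarith [Real.exp_pos (-(L * t))]
      _ = _ := by simp; ring
  have hfix := hcontr.fixedPoint_isFixedPt
  set z := ContractingWith.fixedPoint Φ hcontr
  refine ⟨E z, hE z, fun t ht => ?_⟩
  have h1 : Φ z ⟨t, ht⟩ = z ⟨t, ht⟩ := by rw [hfix]
  have h2 : E z t = Real.exp (L * t) * z ⟨t, ht⟩ := by simp only [E, IccExtend_of_mem hT _ ht]
  rw [h2, ← h1]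
  simp only [Φ, ContinuousMap.coe_mk]
  rw [← mul_assoc, ← Real.exp_add]
  simp

/-- Comparison principle for integral equations with right-hand side antitone in the state. -/
lemma le_of_integral_eq_of_antitone {T y₀ : ℝ} {G : ℝ → ℝ → ℝ} {y z w : ℝ → ℝ}
    (hy : ContinuousOn y (Icc 0 T)) (hz : ContinuousOn z (Icc 0 T))
    (hG : ∀ s ∈ Icc 0 T, Antitone (G s))
    (hGi : IntegrableOn (fun s => G s (y s)) (Ioc 0 T)) (hwi : IntegrableOn w (Ioc 0 T))
    (hye : ∀ t ∈ Icc 0 T, y t = y₀ + ∫ s in (0 : ℝ)..t, G s (y s))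
    (hze : ∀ t ∈ Icc 0 T, z t = y₀ + ∫ s in (0 : ℝ)..t, w s)
    (hle : ∀ᵐ s ∂volume.restrict (Ioc 0 T), G s (z s) ≤ w s) {t : ℝ} (ht : t ∈ Icc 0 T) :
    y t ≤ z t := by
  have hii : ∀ {f : ℝ → ℝ}, IntegrableOn f (Ioc 0 T) → ∀ {a b : ℝ}, 0 ≤ a → a ≤ b → b ≤ T →
      IntervalIntegrable f volume a b := by
    intro f hf a b h0 hab hb
    rw [intervalIntegrable_iff_integrableOn_Ioc_of_le hab]
    exact hf.mono_set (Ioc_subset_Ioc h0 hb)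
  have hsub : Icc 0 t ⊆ Icc 0 T := Icc_subset_Icc_right ht.2
  have hclosed : IsClosed {s ∈ Icc 0 t | y s ≤ z s} :=
    isClosed_Icc.isClosed_le (hy.mono hsub) (hz.mono hsub)
  have h0 : (0 : ℝ) ∈ Icc 0 T := ⟨le_rfl, ht.1.trans ht.2⟩
  have hne : {s ∈ Icc 0 t | y s ≤ z s}.Nonempty :=
    ⟨0, ⟨le_rfl, ht.1⟩, by rw [hye 0 h0, hze 0 h0]; simp⟩
  obtain ⟨r, ⟨hr, hyzr⟩, hmax⟩ :=
    (isCompact_Icc.of_isClosed_subset hclosed (sep_subset _ _)).exists_isGreatest hne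
  have hy' : y t = y r + ∫ s in r..t, G s (y s) := by
    rw [hye t ht, hye r (hsub hr), add_assoc, intervalIntegral.integral_add_adjacent_intervals
      (hii hGi le_rfl hr.1 (hsub hr).2) (hii hGi hr.1 hr.2 ht.2)]
  have hz' : z t = z r + ∫ s in r..t, w s := by
    rw [hze t ht, hze r (hsub hr), add_assoc, intervalIntegral.integral_add_adjacent_intervals
      (hii hwi le_rfl hr.1 (hsub hr).2) (hii hwi hr.1 hr.2 ht.2)]
  rw [hy', hz']
  refine add_le_add hyzr ?_
  rw [intervalIntegral.integral_of_le hr.2, intervalIntegral.integral_of_le hr.2]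
  have hss : Ioc r t ⊆ Ioc 0 T := Ioc_subset_Ioc hr.1 ht.2
  refine setIntegral_mono_on_ae (hGi.mono_set hss) (hwi.mono_set hss) measurableSet_Ioc ?_
  rw [ae_restrict_iff' measurableSet_Ioc] at hle
  filter_upwards [hle] with s h1 hs
  refine le_trans (hG s (Ioc_subset_Icc_self (hss hs)) ?_) (h1 (hss hs))
  by_contra! hlt
  exact (hmax ⟨⟨(hss hs).1.le, hs.2⟩, hlt.le⟩).not_gt hs.1

lemma psiδ_eq {δ : ℝ} (hδ : 0 < δ) (d : ℝ) : psiδ δ d = max 0 (min 1 (1 + d / δ)) := by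
  have hd : d / δ * δ = d := div_mul_cancel₀ d hδ.ne'
  unfold psiδ
  split_ifs with h1 h2
  · rw [max_eq_left]
    exact (min_le_right _ _).trans (by nlinarith)
  · rw [min_eq_right (by nlinarith), max_eq_right (by nlinarith)]
  · rw [min_eq_left (by nlinarith), max_eq_right zero_le_one]

lemma continuous_psiδ {δ : ℝ} (hδ : 0 < δ) : Continuous (psiδ δ) := by
  rw [funext (psiδ_eq hδ)]
  fun_prop

lemma monotone_psiδ {δ : ℝ} (hδ : 0 < δ) : Monotone (psiδ δ) := by
  rw [funext (psiδ_eq hδ)]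
  intro a b hab
  dsimp only
  gcongr

lemma psiδ_nonneg {δ : ℝ} (hδ : 0 < δ) (d : ℝ) : 0 ≤ psiδ δ d := by
  rw [psiδ_eq hδ]
  exact le_max_left _ _

lemma psiδ_le_one {δ : ℝ} (hδ : 0 < δ) (d : ℝ) : psiδ δ d ≤ 1 := by
  rw [psiδ_eq hδ]
  exact max_le zero_le_one (min_le_left _ _)

lemma abs_psiδ_sub_le {δ : ℝ} (hδ : 0 < δ) (a b : ℝ) :
    |psiδ δ a - psiδ δ b| ≤ δ⁻¹ * |a - b| := by
  rw [psiδ_eq hδ, psiδ_eq hδ, max_comm, max_comm 0, min_comm, min_comm 1]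
  refine (abs_max_sub_max_le_abs _ _ _).trans ?_
  refine (abs_inf_sub_inf_le_abs _ _ _).trans ?_
  rw [add_sub_add_left_eq_sub, ← sub_div, abs_div, abs_of_pos hδ, div_eq_inv_mul]

lemma holding_nonneg {Ch Cs : ℝ} (hCh : 0 < Ch) (hCs : 0 < Cs) (x : ℝ) : 0 ≤ holding Ch Cs x := by
  unfold holding
  split_ifs <;> positivity

lemma continuous_holding (Ch Cs : ℝ) : Continuous (holding Ch Cs) := by
  have h : holding Ch Cs = fun x => if 0 ≤ x then Ch * x ^ 2 else Cs * x ^ 2 := by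
    funext x
    rcases lt_or_ge x 0 with h | h
    · simp [holding, h, h.not_ge]
    · simp [holding, h, h.not_gt]
  rw [h]
  refine Continuous.if_le (by fun_prop) (by fun_prop) continuous_const continuous_id fun x hx => ?_
  simp [← hx]

lemma WeakTendsto.congr_ae {X : Type*} [MeasurableSpace X] {μ : Measure X} {f : ℕ → X → ℝ}
    {g g' : X → ℝ} (h : WeakTendsto μ f g) (hg : g =ᵐ[μ] g') : WeakTendsto μ f g' := by
  intro k hk
  have e : ∫ s, k s * g' s ∂μ = ∫ s, k s * g s ∂μ :=
    integral_congr_ae (hg.mono fun s hs => by simp only [hs])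
  rw [e]
  exact h k hk

lemma WeakTendsto.mul_sub {X : Type*} [MeasurableSpace X] {μ : Measure X} [IsFiniteMeasure μ]
    {f : ℕ → X → ℝ} {g c k : X → ℝ} (h : WeakTendsto μ f g) (hf : ∀ n, MemLp (f n) ⊤ μ)
    (hg : MemLp g ⊤ μ) (hc : MemLp c ⊤ μ) (hk : MemLp k ⊤ μ) :
    WeakTendsto μ (fun n s => f n s * c s - k s) (fun s => g s * c s - k s) := by
  intro p hp
  have e : ∀ q : X → ℝ, MemLp q ⊤ μ → ∫ s, p s * (q s * c s - k s) ∂μ =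
      ∫ s, p s * c s * q s ∂μ - ∫ s, p s * k s ∂μ := by
    intro q hq
    rw [← integral_sub (integrable_of_memLp_top (memLp_top_mul (memLp_top_mul hp hc) hq))
      (integrable_of_memLp_top (memLp_top_mul hp hk))]
    congr 1 with s
    ring
  rw [e g hg]
  simp only [e _ (hf _)]
  exact (h _ (memLp_top_mul hp hc)).sub_const _

lemma memLp_top_of_continuousOn_Icc {T : ℝ} {f : ℝ → ℝ} (hf : ContinuousOn f (Icc 0 T)) :
    MemLp f ⊤ (volume.restrict (Ioc 0 T)) := by
  obtain ⟨C, hC⟩ := isCompact_Icc.exists_bound_of_continuousOn hf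
  exact memLp_top_of_bound
    ((hf.mono Ioc_subset_Icc_self).aestronglyMeasurable measurableSet_Ioc) C
    ((ae_restrict_mem measurableSet_Ioc).mono fun s hs => hC s (Ioc_subset_Icc_self hs))

/-- Every bounded drift generates a state of the smoothed system. -/
lemma exists_isStateInv {T a δ M : ℝ} {α β u : ℝ → ℝ} (hT : 0 ≤ T) (hδ : 0 < δ)
    (hr : MemLp (fun s => u s * (1 + a * β s) - α s / 2) ⊤ (volume.restrict (Ioc 0 T)))
    (hM : ∀ s ∈ Icc 0 T, |u s * (1 + a * β s) - α s / 2| ≤ M) (x₀ y₀ : ℝ) :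
    ∃ x y : ℝ → ℝ, IsStateInv T a δ α β u x₀ y₀ x y := by
  set r : ℝ → ℝ := fun s => u s * (1 + a * β s) - α s / 2
  have hM0 : 0 ≤ M := (abs_nonneg _).trans (hM 0 ⟨le_rfl, hT⟩)
  have hri : IntegrableOn r (Icc 0 T) := by
    rw [integrableOn_Icc_iff_integrableOn_Ioc]
    exact integrable_of_memLp_top hr
  let x : ℝ → ℝ := fun t => x₀ + ∫ s in (0 : ℝ)..t, r s
  have hx : ContinuousOn x (Icc 0 T) := by
    have := intervalIntegral.continuousOn_primitive_interval (a := 0) (b := T) (μ := volume)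
      (f := r) (by rwa [uIcc_of_le hT])
    rw [uIcc_of_le hT] at this
    exact continuousOn_const.add this
  have hint : ∀ z : ℝ → ℝ, Continuous z →
      IntegrableOn (fun s => max (r s) 0 * psiδ δ (x s - z s)) (Icc 0 T) := by
    intro z hz
    refine hri.pos_part.mul_bdd (c := 1) ?_ (.of_forall fun s => ?_)
    · exact ((continuous_psiδ hδ).comp_continuousOn
        (hx.sub hz.continuousOn)).aestronglyMeasurable measurableSet_Icc
    · rw [Real.norm_eq_abs, abs_of_nonneg (psiδ_nonneg hδ _)]
      exact psiδ_le_one hδ _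
  have hLip : ∀ s ∈ Icc 0 T, ∀ b c, |max (r s) 0 * psiδ δ (x s - b) -
      max (r s) 0 * psiδ δ (x s - c)| ≤ (M + 1) * δ⁻¹ * |b - c| := by
    intro s hs b c
    have h1 : max (r s) 0 ≤ M + 1 :=
      max_le ((le_abs_self _).trans ((hM s hs).trans (by linarith))) (by linarith)
    rw [← mul_sub, abs_mul, abs_of_nonneg (le_max_right _ _), mul_assoc]
    refine mul_le_mul h1 ((abs_psiδ_sub_le hδ _ _).trans_eq ?_) (abs_nonneg _) (by linarith)
    rw [sub_sub_sub_cancel_left, abs_sub_comm]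
  obtain ⟨y, hy, hye⟩ := exists_caratheodory_solution hT (by positivity) hint hLip y₀
  exact ⟨x, y, hx, hy.continuousOn, fun t ht => ⟨rfl, hye t ht⟩⟩

lemma JhatInv_eq {T a σ Ch Cs ChT CsT : ℝ} {α β u x y : ℝ → ℝ} (hT : 0 ≤ T)
    (hu : MemLp u ⊤ (volume.restrict (Ioc 0 T)))
    (hβ : ContinuousOn β (Icc 0 T))
    (he : ContinuousOn (fun s => α s ^ 2 / (4 * β s)) (Icc 0 T))
    (hx : ContinuousOn x (Icc 0 T)) :
    JhatInv T a σ Ch Cs ChT CsT α β u x y =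
      -(∫ s in Ioc 0 T, a * u s ^ 2 * (1 + a * β s)) + (∫ s in Ioc 0 T, α s ^ 2 / (4 * β s))
        - (∫ s in Ioc 0 T, holding Ch Cs (x s)) - holding ChT CsT (x T) - σ * y T := by
  have h1 : IntegrableOn (fun s => a * u s ^ 2 * (1 + a * β s)) (Ioc 0 T) := by
    refine integrable_of_memLp_top (memLp_top_mul (g := fun s => 1 + a * β s) ?_
      (memLp_top_of_continuousOn_Icc (by fun_prop)))
    simpa only [pow_two] using (memLp_top_mul hu hu).const_mul a
  have h2 : IntegrableOn (fun s => α s ^ 2 / (4 * β s)) (Ioc 0 T) :=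
    integrable_of_memLp_top (memLp_top_of_continuousOn_Icc he)
  have h3 : IntegrableOn (fun s => holding Ch Cs (x s)) (Ioc 0 T) :=
    integrable_of_memLp_top (memLp_top_of_continuousOn_Icc
      ((continuous_holding Ch Cs).comp_continuousOn hx))
  have h4 : IntegrableOn (fun s => -(a * u s ^ 2 * (1 + a * β s)) + α s ^ 2 / (4 * β s))
      (Ioc 0 T) := h1.fun_neg.add h2
  rw [JhatInv, intervalIntegral.integral_of_le hT, integral_sub h4 h3,
    integral_add h1.fun_neg h2, integral_neg]

lemma exists_bound_of_memSu {T a : ℝ} {α β : ℝ → ℝ} (ha : 0 < a)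
    (hαc : ContinuousOn α (Icc 0 T)) (hβc : ContinuousOn β (Icc 0 T))
    (hβ : ∀ t ∈ Icc (0 : ℝ) T, 0 < β t) :
    ∃ U M : ℝ, ∀ u, memSu T a α β u → ∀ s ∈ Icc 0 T,
      |u s| ≤ U ∧ |u s * (1 + a * β s) - α s / 2| ≤ M := by
  have hcap : ContinuousOn (fun t => α t / (2 * a * β t)) (Icc 0 T) :=
    hαc.div (by fun_prop) fun t ht => (mul_pos (by positivity) (hβ t ht)).ne'
  obtain ⟨U, hU⟩ := isCompact_Icc.exists_bound_of_continuousOn hcap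
  obtain ⟨B, hB⟩ := isCompact_Icc.exists_bound_of_continuousOn
    (f := fun t => 1 + a * β t) (s := Icc 0 T) (by fun_prop)
  obtain ⟨A, hA⟩ := isCompact_Icc.exists_bound_of_continuousOn
    (f := fun t => α t / 2) (s := Icc 0 T) (by fun_prop)
  refine ⟨U, U * B + A, fun u hu s hs => ?_⟩
  have h1 : |u s| ≤ U := by
    rw [abs_of_nonneg (hu.2 s hs).1]
    exact (hu.2 s hs).2.trans ((le_abs_self _).trans (hU s hs))
  refine ⟨h1, (abs_sub _ _).trans (add_le_add ?_ (hA s hs))⟩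
  rw [abs_mul]
  exact mul_le_mul h1 (hB s hs) (abs_nonneg _) ((abs_nonneg _).trans h1)

/-- Upper semicontinuity of the objective under weak convergence of controls and storage rates. -/
lemma le_JhatInv_of_weakTendsto {T a σ δ Ch Cs ChT CsT : ℝ} {α β : ℝ → ℝ}
    (hT : 0 ≤ T) (ha : 0 < a) (hσ : 0 ≤ σ) (hδ : 0 < δ)
    (hαc : ContinuousOn α (Icc 0 T)) (hβc : ContinuousOn β (Icc 0 T))
    (hβ : ∀ t ∈ Icc (0 : ℝ) T, 0 < β t) {x₀ y₀ : ℝ} {u x y : ℕ → ℝ → ℝ}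
    (hu : ∀ n, memSu T a α β (u n)) (hxy : ∀ n, IsStateInv T a δ α β (u n) x₀ y₀ (x n) (y n))
    {v w p q : ℝ → ℝ} (hv : memSu T a α β v) (hpq : IsStateInv T a δ α β v x₀ y₀ p q)
    (huv : WeakTendsto (volume.restrict (Ioc 0 T)) u v)
    (hw : MemLp w ⊤ (volume.restrict (Ioc 0 T)))
    (hyw : WeakTendsto (volume.restrict (Ioc 0 T))
      (fun n s => max (u n s * (1 + a * β s) - α s / 2) 0 * psiδ δ (x n s - y n s)) w)
    {l : ℝ} (hl : Filter.Tendsto (fun n => JhatInv T a σ Ch Cs ChT CsT α β (u n) (x n) (y n))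
      Filter.atTop (nhds l)) :
    l ≤ JhatInv T a σ Ch Cs ChT CsT α β v p q := by
  set μ := volume.restrict (Ioc 0 T)
  obtain ⟨U, M, hUM⟩ := exists_bound_of_memSu ha hαc hβc hβ
  have hTT : T ∈ Icc 0 T := ⟨hT, le_rfl⟩
  have hμ : ∀ {P : ℝ → Prop}, (∀ s ∈ Icc 0 T, P s) → ∀ᵐ s ∂μ, P s := fun h =>
    (ae_restrict_mem measurableSet_Ioc).mono fun s hs => h s (Ioc_subset_Icc_self hs)
  have hct : MemLp (fun s => 1 + a * β s) ⊤ μ := memLp_top_of_continuousOn_Icc (by fun_prop)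
  have hαt : MemLp (fun s => α s / 2) ⊤ μ := memLp_top_of_continuousOn_Icc (by fun_prop)
  have hSt : ∀ {u : ℝ → ℝ}, memSu T a α β u → MemLp u ⊤ μ := fun hu =>
    memLp_top_of_bound hu.1.aestronglyMeasurable U (hμ fun s hs => (hUM _ hu s hs).1)
  have hrt : ∀ {u : ℝ → ℝ}, memSu T a α β u →
      MemLp (fun s => u s * (1 + a * β s) - α s / 2) ⊤ μ := fun hu =>
    (memLp_top_mul (hSt hu) hct).sub hαt
  have hr := huv.mul_sub (fun n => hSt (hu n)) (hSt hv) hct hαt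
  have hx : ∀ t ∈ Icc 0 T, Filter.Tendsto (fun n => x n t) Filter.atTop (nhds (p t)) := by
    intro t ht
    rw [(hpq.2.2 t ht).1]
    simp only [((hxy _).2.2 t ht).1]
    exact (hr.tendsto_primitive ht).const_add x₀
  let z : ℝ → ℝ := fun t => y₀ + ∫ s in (0 : ℝ)..t, w s
  have hwi : IntegrableOn w (Ioc 0 T) := integrable_of_memLp_top hw
  have hz : ContinuousOn z (Icc 0 T) := by
    have := intervalIntegral.continuousOn_primitive_interval (a := 0) (b := T) (μ := volume)
      (f := w) (by rwa [uIcc_of_le hT, integrableOn_Icc_iff_integrableOn_Ioc])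
    rw [uIcc_of_le hT] at this
    exact continuousOn_const.add this
  have hy : ∀ t ∈ Icc 0 T, Filter.Tendsto (fun n => y n t) Filter.atTop (nhds (z t)) := by
    intro t ht
    simp only [((hxy _).2.2 t ht).2, z]
    exact (hyw.tendsto_primitive ht).const_add y₀
  have hψt : ∀ {x y : ℝ → ℝ}, ContinuousOn x (Icc 0 T) → ContinuousOn y (Icc 0 T) →
      MemLp (fun s => psiδ δ (x s - y s)) ⊤ μ := fun hx hy =>
    memLp_top_of_continuousOn_Icc ((continuous_psiδ hδ).comp_continuousOn (hx.sub hy))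
  have hψ1 : ∀ d, ‖psiδ δ d‖ ≤ 1 := fun d => by
    rw [Real.norm_eq_abs, abs_of_nonneg (psiδ_nonneg hδ d)]
    exact psiδ_le_one hδ d
  have hmaxt : ∀ {r : ℝ → ℝ}, MemLp r ⊤ μ → MemLp (fun s => max (r s) 0) ⊤ μ :=
    fun hr => hr.pos_part
  have hle : ∀ᵐ s ∂μ, max (v s * (1 + a * β s) - α s / 2) 0 * psiδ δ (p s - z s) ≤ w s := by
    -- multiply the drifts by the indicator of the set where the limit drift is positive
    let r : ℝ → ℝ := fun s => v s * (1 + a * β s) - α s / 2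
    let r' := (hrt hv).1.mk r
    have hr' : r =ᵐ[μ] r' := (hrt hv).1.ae_eq_mk
    let P : Set ℝ := {s | 0 < r' s}
    have hP : MeasurableSet P :=
      measurableSet_lt measurable_const (hrt hv).1.stronglyMeasurable_mk.measurable
    let k : ℝ → ℝ := P.indicator fun _ => 1
    have hk0 : ∀ s, 0 ≤ k s := fun s => indicator_nonneg (fun _ _ => zero_le_one) s
    have hk1 : ∀ s, k s ≤ 1 := fun s => indicator_le_self' (fun _ _ => zero_le_one) s
    have hkt : MemLp k ⊤ μ := memLp_top_of_bound (aestronglyMeasurable_const.indicator hP) 1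
      (.of_forall fun s => by rw [Real.norm_eq_abs, abs_of_nonneg (hk0 s)]; exact hk1 s)
    have hkψ1 : ∀ s d, ‖k s * psiδ δ d‖ ≤ 1 := fun s d => by
      rw [norm_mul, Real.norm_eq_abs, abs_of_nonneg (hk0 s)]
      exact mul_le_one₀ (hk1 s) (norm_nonneg _) (hψ1 d)
    have hlim := hr.mul (q := fun n s => k s * psiδ δ (x n s - y n s))
      (p := fun s => k s * psiδ δ (p s - z s)) (C := M) (D := 1)
      (fun n => (hrt (hu n)).1) (fun n => hμ fun s hs => (hUM _ (hu n) s hs).2)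
      (fun n => hkt.1.mul (hψt (hxy n).1 (hxy n).2.1).1) (hkt.1.mul (hψt hpq.1 hz).1)
      (fun n => .of_forall fun s => hkψ1 _ _) (.of_forall fun s => hkψ1 _ _)
      (hμ fun s hs => (((continuous_psiδ hδ).tendsto _).comp
        ((hx s hs).sub (hy s hs))).const_mul (k s))
    have hfin := hlim.ae_le hyw
      (fun n => integrable_of_memLp_top (memLp_top_mul
        (memLp_top_mul hkt (hψt (hxy n).1 (hxy n).2.1)) (hrt (hu n))))
      (fun n => integrable_of_memLp_top (memLp_top_mul (hmaxt (hrt (hu n)))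
        (hψt (hxy n).1 (hxy n).2.1)))
      (integrable_of_memLp_top (memLp_top_mul (memLp_top_mul hkt (hψt hpq.1 hz)) (hrt hv)))
      hwi (fun n => .of_forall fun s => by
        have h1 : k s * (u n s * (1 + a * β s) - α s / 2) ≤
            max (u n s * (1 + a * β s) - α s / 2) 0 :=
          (mul_le_mul_of_nonneg_left (le_max_left _ 0) (hk0 s)).trans
            (mul_le_of_le_one_left (le_max_right _ _) (hk1 s))
        calc _ = k s * (u n s * (1 + a * β s) - α s / 2) * psiδ δ (x n s - y n s) := by ring
          _ ≤ _ := mul_le_mul_of_nonneg_right h1 (psiδ_nonneg hδ _))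
    filter_upwards [hfin, hr'] with s h1 h2
    refine le_trans (le_of_eq ?_) h1
    have h3 : max (r s) 0 = k s * r s := by
      by_cases hs : s ∈ P
      · have : 0 < r' s := hs
        simp only [k, indicator_of_mem hs, one_mul]
        exact max_eq_left (by rw [h2]; exact this.le)
      · have : ¬ 0 < r' s := hs
        simp only [k, indicator_of_notMem hs, zero_mul]
        exact max_eq_right (by rw [h2]; exact not_lt.1 this)
    calc _ = max (r s) 0 * psiδ δ (p s - z s) := rfl
      _ = k s * psiδ δ (p s - z s) * r s := by rw [h3]; ring
  have hqz : q T ≤ z T := by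
    refine le_of_integral_eq_of_antitone (y₀ := y₀)
      (G := fun s b => max (v s * (1 + a * β s) - α s / 2) 0 * psiδ δ (p s - b))
      hpq.2.1 hz ?_ ?_ hwi (fun t ht => (hpq.2.2 t ht).2) (fun t _ => rfl) hle hTT
    · intro s _ b c hbc
      exact mul_le_mul_of_nonneg_left (monotone_psiδ hδ (sub_le_sub_left hbc _))
        (le_max_right _ _)
    · exact integrable_of_memLp_top (memLp_top_mul (hmaxt (hrt hv)) (hψt hpq.1 hpq.2.1))
  have he : ContinuousOn (fun s => α s ^ 2 / (4 * β s)) (Icc 0 T) :=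
    (hαc.pow 2).div (by fun_prop) fun t ht => (mul_pos (by norm_num) (hβ t ht)).ne'
  have hxb : ∀ n, ∀ t ∈ Icc 0 T, |x n t| ≤ |x₀| + M * T := by
    intro n t ht
    have hM0 : 0 ≤ M := (abs_nonneg _).trans (hUM _ (hu n) t ht).2
    rw [((hxy n).2.2 t ht).1]
    refine (abs_add_le _ _).trans (add_le_add_right ?_ _)
    have := intervalIntegral.norm_integral_le_of_norm_le_const (a := 0) (b := t) (C := M)
      (f := fun s => u n s * (1 + a * β s) - α s / 2) fun s hs => by
        rw [uIoc_of_le ht.1] at hs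
        exact (hUM _ (hu n) s ⟨hs.1.le, hs.2.trans ht.2⟩).2
    rw [sub_zero, abs_of_nonneg ht.1] at this
    exact this.trans (mul_le_mul_of_nonneg_left ht.2 hM0)
  have hhold : Filter.Tendsto (fun n => ∫ s in Ioc 0 T, holding Ch Cs (x n s)) Filter.atTop
      (nhds (∫ s in Ioc 0 T, holding Ch Cs (p s))) := by
    obtain ⟨H, hH⟩ :=
      (isCompact_Icc (a := -(|x₀| + M * T)) (b := |x₀| + M * T)).exists_bound_of_continuousOn
        (continuous_holding Ch Cs).continuousOn
    refine tendsto_integral_of_dominated_convergence (fun _ => H)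
      (fun n => (memLp_top_of_continuousOn_Icc
        ((continuous_holding Ch Cs).comp_continuousOn (hxy n).1)).1)
      (integrable_const H) (fun n => hμ fun s hs => hH _ (abs_le.1 (hxb n s hs)))
      (hμ fun s hs => ((continuous_holding Ch Cs).tendsto _).comp (hx s hs))
  have hquad := huv (fun s => 2 * a * v s * (1 + a * β s))
    (memLp_top_mul ((hSt hv).const_mul (2 * a)) hct)
  have hqt : ∀ {f : ℝ → ℝ}, MemLp f ⊤ μ →
      IntegrableOn (fun s => a * f s ^ 2 * (1 + a * β s)) (Ioc 0 T) := by
    intro f hf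
    refine integrable_of_memLp_top (memLp_top_mul (f := fun s => a * f s ^ 2) ?_ hct)
    simpa only [pow_two] using (memLp_top_mul hf hf).const_mul a
  have hlt : ∀ {f : ℝ → ℝ}, MemLp f ⊤ μ →
      IntegrableOn (fun s => 2 * a * v s * (1 + a * β s) * f s) (Ioc 0 T) := fun hf =>
    integrable_of_memLp_top (memLp_top_mul (memLp_top_mul ((hSt hv).const_mul (2 * a)) hct) hf)
  have hconv : ∀ n, (∫ s in Ioc 0 T, 2 * a * v s * (1 + a * β s) * u n s) -
      (∫ s in Ioc 0 T, a * v s ^ 2 * (1 + a * β s)) ≤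
      ∫ s in Ioc 0 T, a * u n s ^ 2 * (1 + a * β s) := by
    intro n
    rw [← integral_sub (hlt (hSt (hu n))) (hqt (hSt hv))]
    refine integral_mono_ae ((hlt (hSt (hu n))).sub (hqt (hSt hv))) (hqt (hSt (hu n)))
      (hμ fun s hs => ?_)
    have : 0 ≤ a * (1 + a * β s) := by
      have := hβ s hs
      positivity
    have h2 := mul_nonneg this (sq_nonneg (u n s - v s))
    dsimp only
    linarith
  have hvv : ∫ s in Ioc 0 T, 2 * a * v s * (1 + a * β s) * v s =
      2 * ∫ s in Ioc 0 T, a * v s ^ 2 * (1 + a * β s) := by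
    rw [← integral_const_mul]
    congr 1 with s
    ring
  rw [hvv] at hquad
  have hlim := ((((hquad.sub_const (∫ s in Ioc 0 T, a * v s ^ 2 * (1 + a * β s))).neg.add_const
    (∫ s in Ioc 0 T, α s ^ 2 / (4 * β s))).sub hhold).sub
    (((continuous_holding ChT CsT).tendsto _).comp (hx T hTT))).sub ((hy T hTT).const_mul σ)
  have hbound := le_of_tendsto_of_tendsto' hl hlim fun n => by
    rw [JhatInv_eq hT (hSt (hu n)) hβc he (hxy n).1]
    have := hconv n
    simp only [Function.comp_apply]
    gcongr
  rw [JhatInv_eq hT (hSt hv) hβc he hpq.1]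
  refine hbound.trans ?_
  have := mul_le_mul_of_nonneg_left hqz hσ
  linarith

/-- existence of an optimal policy for the smoothed
inventory-storage problem. -/
theorem exists_optimal_policy_smoothed_inventory
    (T a σ δ Ch Cs ChT CsT : ℝ)
    (hT : 0 < T) (ha : 0 < a) (hσ : 0 ≤ σ) (hδ : 0 < δ)
    (hCh : 0 < Ch) (hCs : 0 < Cs) (hChT : 0 < ChT) (hCsT : 0 < CsT)
    (α β : ℝ → ℝ)
    (hαLip : ∃ K : ℝ≥0, LipschitzOnWith K α (Icc 0 T))
    (hβLip : ∃ K : ℝ≥0, LipschitzOnWith K β (Icc 0 T))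
    (hα : ∀ t ∈ Icc (0 : ℝ) T, 0 < α t) (hβ : ∀ t ∈ Icc (0 : ℝ) T, 0 < β t)
    (x₀ y₀ : ℝ) (hxy : x₀ ≤ y₀) :
    ∃ ustar xstar ystar : ℝ → ℝ,
      memSu T a α β ustar ∧ IsStateInv T a δ α β ustar x₀ y₀ xstar ystar ∧
      ∀ u x y : ℝ → ℝ, memSu T a α β u → IsStateInv T a δ α β u x₀ y₀ x y →
        JhatInv T a σ Ch Cs ChT CsT α β u x y
          ≤ JhatInv T a σ Ch Cs ChT CsT α β ustar xstar ystar := by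
  have hαc : ContinuousOn α (Icc 0 T) := hαLip.choose_spec.continuousOn
  have hβc : ContinuousOn β (Icc 0 T) := hβLip.choose_spec.continuousOn
  have hcap : ContinuousOn (fun t => α t / (2 * a * β t)) (Icc 0 T) :=
    hαc.div (by fun_prop) fun t ht => (mul_pos (by positivity) (hβ t ht)).ne'
  have hcap0 : ∀ t ∈ Icc 0 T, 0 ≤ α t / (2 * a * β t) := fun t ht => by
    have := hα t ht
    have := hβ t ht
    positivity
  have he : ContinuousOn (fun s => α s ^ 2 / (4 * β s)) (Icc 0 T) :=
    (hαc.pow 2).div (by fun_prop) fun t ht => (mul_pos (by norm_num) (hβ t ht)).ne'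
  obtain ⟨U, M, hUM⟩ := exists_bound_of_memSu ha hαc hβc hβ
  set μ := volume.restrict (Ioc 0 T)
  have hμ : ∀ {P : ℝ → Prop}, (∀ s ∈ Icc 0 T, P s) → ∀ᵐ s ∂μ, P s := fun h =>
    (ae_restrict_mem measurableSet_Ioc).mono fun s hs => h s (Ioc_subset_Icc_self hs)
  have hSt : ∀ {u : ℝ → ℝ}, memSu T a α β u → MemLp u ⊤ μ := fun hu =>
    memLp_top_of_bound hu.1.aestronglyMeasurable U (hμ fun s hs => (hUM _ hu s hs).1)
  have hrt : ∀ {u : ℝ → ℝ}, memSu T a α β u →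
      MemLp (fun s => u s * (1 + a * β s) - α s / 2) ⊤ μ := fun hu =>
    (memLp_top_mul (hSt hu) (memLp_top_of_continuousOn_Icc (by fun_prop))).sub
      (memLp_top_of_continuousOn_Icc (by fun_prop))
  have hstate : ∀ u, memSu T a α β u → ∃ x y, IsStateInv T a δ α β u x₀ y₀ x y := fun u hu =>
    exists_isStateInv hT.le hδ (hrt hu) (fun s hs => (hUM u hu s hs).2) x₀ y₀
  let S : Set ℝ := {l | ∃ u x y, memSu T a α β u ∧ IsStateInv T a δ α β u x₀ y₀ x y ∧
    JhatInv T a σ Ch Cs ChT CsT α β u x y = l}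
  have hSne : S.Nonempty := by
    have h0 : memSu T a α β fun _ => 0 := ⟨measurable_const, fun t ht => ⟨le_rfl, hcap0 t ht⟩⟩
    obtain ⟨x, y, h⟩ := hstate _ h0
    exact ⟨_, _, x, y, h0, h, rfl⟩
  have hSb : BddAbove S := by
    refine ⟨(∫ s in Ioc 0 T, α s ^ 2 / (4 * β s)) - σ * y₀, ?_⟩
    rintro _ ⟨u, x, y, hu, h, rfl⟩
    rw [JhatInv_eq hT.le (hSt hu) hβc he h.1]
    have h1 : 0 ≤ ∫ s in Ioc 0 T, a * u s ^ 2 * (1 + a * β s) :=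
      setIntegral_nonneg measurableSet_Ioc fun s hs => by
        have := hβ s (Ioc_subset_Icc_self hs)
        positivity
    have h2 : 0 ≤ ∫ s in Ioc 0 T, holding Ch Cs (x s) :=
      setIntegral_nonneg measurableSet_Ioc fun s _ => holding_nonneg hCh hCs _
    have h3 := holding_nonneg hChT hCsT (x T)
    have h4 : y₀ ≤ y T := by
      rw [(h.2.2 T ⟨hT.le, le_rfl⟩).2]
      exact le_add_of_nonneg_right (intervalIntegral.integral_nonneg hT.le fun s _ =>
        mul_nonneg (le_max_right _ _) (psiδ_nonneg hδ _))
    have := mul_le_mul_of_nonneg_left h4 hσ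
    linarith
  obtain ⟨l, -, hl, hlS⟩ := exists_seq_tendsto_sSup hSne hSb
  choose u x y hu hs hJ using hlS
  obtain ⟨φ, hφ, v₀, hv₀, hv₀b, huv₀⟩ := exists_weakTendsto_of_bound (μ := μ) (C := U)
    (fun n => (hSt (hu n)).1) fun n => hμ fun s hs => (hUM _ (hu n) s hs).1
  have hv₀i : Integrable v₀ μ :=
    integrable_of_memLp_top (memLp_top_of_bound hv₀.aestronglyMeasurable U hv₀b)
  have hup : v₀ ≤ᵐ[μ] fun t => α t / (2 * a * β t) :=
    huv₀.ae_le (WeakTendsto.const _) (fun n => integrable_of_memLp_top (hSt (hu _)))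
      (fun _ => integrable_of_memLp_top (memLp_top_of_continuousOn_Icc hcap)) hv₀i
      (integrable_of_memLp_top (memLp_top_of_continuousOn_Icc hcap))
      fun n => hμ fun s hs => ((hu _).2 s hs).2
  have hlo : (fun _ => 0) ≤ᵐ[μ] v₀ :=
    (WeakTendsto.const fun _ => (0 : ℝ)).ae_le huv₀ (fun _ => integrable_const _)
      (fun n => integrable_of_memLp_top (hSt (hu _))) (integrable_const _) hv₀i
      fun n => hμ fun s hs => ((hu _).2 s hs).1
  obtain ⟨N, hN, hNm, hN0⟩ := exists_measurable_superset_of_null (ae_iff.1 (hup.and hlo))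
  let v : ℝ → ℝ := Nᶜ.indicator v₀
  have hv : memSu T a α β v := by
    refine ⟨hv₀.indicator hNm.compl, fun t ht => ?_⟩
    by_cases htN : t ∈ N
    · simp only [v, indicator_of_notMem (notMem_compl_iff.2 htN)]
      exact ⟨le_rfl, hcap0 t ht⟩
    · simp only [v, indicator_of_mem (mem_compl htN)]
      have := not_not.1 fun h => htN (hN h)
      exact ⟨this.2, this.1⟩
  have hvv : v₀ =ᵐ[μ] v := by
    filter_upwards [measure_eq_zero_iff_ae_notMem.1 hN0] with s hs
    simp only [v, indicator_of_mem (mem_compl hs)]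
  have huv := huv₀.congr_ae hvv
  have hwt : ∀ n, AEStronglyMeasurable (fun s => max (u n s * (1 + a * β s) - α s / 2) 0 *
      psiδ δ (x n s - y n s)) μ := fun n =>
    (hrt (hu n)).pos_part.1.mul (memLp_top_of_continuousOn_Icc
      ((continuous_psiδ hδ).comp_continuousOn ((hs n).1.sub (hs n).2.1))).1
  obtain ⟨ψ, hψ, w, hw, hwb, hyw⟩ := exists_weakTendsto_of_bound (μ := μ) (C := M)
    (fun n => hwt (φ n)) fun n => hμ fun s hs => by
      have hM := (hUM _ (hu (φ n)) s hs).2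
      rw [norm_mul, Real.norm_eq_abs, Real.norm_eq_abs, abs_of_nonneg (le_max_right _ _),
        abs_of_nonneg (psiδ_nonneg hδ _)]
      exact (mul_le_of_le_one_right (le_max_right _ _) (psiδ_le_one hδ _)).trans
        (max_le ((le_abs_self _).trans hM) ((abs_nonneg _).trans hM))
  obtain ⟨p, q, hpq⟩ := hstate v hv
  refine ⟨v, p, q, hv, hpq, fun u' x' y' hu' hs' => ?_⟩
  refine (le_csSup hSb ⟨u', x', y', hu', hs', rfl⟩).trans ?_
  refine le_JhatInv_of_weakTendsto hT.le ha hσ hδ hαc hβc hβ (u := fun n => u (φ (ψ n)))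
    (fun n => hu _) (fun n => hs _) hv hpq
    (huv.comp_strictMono hψ) (memLp_top_of_bound hw.aestronglyMeasurable M hwb) hyw ?_
  simp only [hJ]
  exact hl.comp (hφ.comp hψ).tendsto_atTop
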